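/- Let φ, Q, λ > 0, u_γ > 1, set C = (u_γ − 1)/(u_γ + 1), define u(s) = (C + exp(2λφ s/Q))/(exp(2λφ s/Q) − C) for s ≥ 0, let 0 < δ < u_γ − 1 and ε_μ = (Q/(2λφ))·ln(C(2+δ)/δ). Then for every s ≥ 0, u(s) > 1 + δ if and only if s < ε_μ; that is, the region where the concentration exceeds the cutoff value 1 + δ is exactly the layer [0, ε_μ). -/

import Mathlib

/-- For the steady solution `u(s) = (C + exp(2λφ s/Q))/(exp(2λφ s/Q) − C)`,
`C = (u_γ − 1)/(u_γ + 1)`, `u_γ > 1`, cutoff `0 < δ < u_γ − 1`, and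
`ε_μ = (Q/(2λφ))·ln(C(2+δ)/δ)`: for every `s ≥ 0`, the concentration exceeds the
cutoff value `1 + δ` if and only if `s < ε_μ`, i.e. the reactive layer is exactly
`[0, ε_μ)`. -/
theorem stmt_8 (φ Q lam uγ δ : ℝ) (hφ : 0 < φ) (hQ : 0 < Q) (hlam : 0 < lam)
    (huγ : 1 < uγ) (hδ : 0 < δ) (hδuγ : δ < uγ - 1)
    (C : ℝ) (hC : C = (uγ - 1) / (uγ + 1))
    (u : ℝ → ℝ)
    (hu : ∀ s : ℝ, u s =
      (C + Real.exp (2 * lam * φ * s / Q)) / (Real.exp (2 * lam * φ * s / Q) - C))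
    (εμ : ℝ) (hε : εμ = Q / (2 * lam * φ) * Real.log (C * (2 + δ) / δ)) :
    ∀ s : ℝ, 0 ≤ s → (1 + δ < u s ↔ s < εμ) := by
  intro s hs
  have hC0 : 0 < C := by
    rw [hC]
    exact div_pos (by linarith) (by linarith)
  have hC1 : C < 1 := by
    rw [hC, div_lt_one (by linarith)]
    linarith
  have hE : 1 ≤ Real.exp (2 * lam * φ * s / Q) := Real.one_le_exp (by positivity)
  have hlog : s < εμ ↔ 2 * lam * φ * s / Q < Real.log (C * (2 + δ) / δ) := by
    rw [hε, div_mul_eq_mul_div, lt_div_iff₀ (by positivity), div_lt_iff₀ hQ,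
      mul_comm s, mul_comm Q]
  rw [hlog, Real.lt_log_iff_exp_lt (by positivity), hu, lt_div_iff₀ (by linarith),
    lt_div_iff₀ hδ]
  constructor <;> intro h <;> linarith
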